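/- arXiv:2411.08151 — 2 statements merged into one kernel-verified Lean document; each statement's English description precedes it below -/
import Mathlib

section
/- There exist universal constants C, C' ≥ 1 such that for all integers n, p ≥ 1: DDP(n,p) ≤ C·( DADP(⌈C'·DDP(n,p)/p⌉, p)^{1/2} · n^{1/2} · p^{1/2} + n^{1/2}·p + n ). -/
open Finset

/-- A walk in a directed edge set `F`, given as the list of visited vertices. -/
def IsWalkOn {V : Type} (F : Finset (V × V)) (s t : V) (l : List V) : Prop :=
  l.Chain' (fun a b => (a, b) ∈ F) ∧ l.head? = some s ∧ l.getLast? = some t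

def ReachableOn {V : Type} (F : Finset (V × V)) (s t : V) : Prop :=
  ∃ l, IsWalkOn F s t l

/-- A directed weighted graph: a finite set of directed edges together with weights. -/
structure WDigraph (V : Type) where
  Edge : Finset (V × V)
  w : V × V → ℝ

namespace WDigraph

variable {V : Type}

/-- Total weight of a walk (sum of weights of consecutive pairs). -/
def walkWeight (G : WDigraph V) (l : List V) : ℝ :=
  ((l.zip l.tail).map G.w).sum

/-- Distance from `s` to `t` using only edges of `F`, with weights of `G`. -/
noncomputable def distOn (G : WDigraph V) (F : Finset (V × V)) (s t : V) : ℝ :=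
  sInf {x | ∃ l, IsWalkOn F s t l ∧ G.walkWeight l = x}

def IsWalk (G : WDigraph V) (s t : V) (l : List V) : Prop :=
  IsWalkOn G.Edge s t l

def Reachable (G : WDigraph V) (s t : V) : Prop :=
  ReachableOn G.Edge s t

noncomputable def dist (G : WDigraph V) (s t : V) : ℝ :=
  G.distOn G.Edge s t

/-- All edge weights equal to `1`. -/
def Unweighted (G : WDigraph V) : Prop := ∀ e ∈ G.Edge, G.w e = 1

/-- All edge weights positive. -/
def PosWeights (G : WDigraph V) : Prop := ∀ e ∈ G.Edge, 0 < G.w e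

/-- `F` is (the edge set of) an exact distance preserver of `(G, P)`. -/
def IsExactPreserver (G : WDigraph V) (F : Finset (V × V)) (P : Finset (V × V)) : Prop :=
  F ⊆ G.Edge ∧ ∀ q ∈ P, ReachableOn F q.1 q.2 ∧ G.distOn F q.1 q.2 = G.dist q.1 q.2

/-- Total (in plus out) degree of a vertex. -/
def degree [DecidableEq V] (G : WDigraph V) (v : V) : ℕ :=
  (G.Edge.filter fun e => e.1 = v ∨ e.2 = v).card

end WDigraph
/-- An undirected weighted graph: a finite set of undirected edges together with weights. -/
structure WGraph (V : Type) where
  Edge : Finset (Sym2 V)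
  w : Sym2 V → ℝ

namespace WGraph

variable {V : Type}

def walkWeight (G : WGraph V) (l : List V) : ℝ :=
  ((l.zip l.tail).map fun p => G.w s(p.1, p.2)).sum

def IsWalkOn (F : Finset (Sym2 V)) (s t : V) (l : List V) : Prop :=
  l.Chain' (fun a b => s(a, b) ∈ F) ∧ l.head? = some s ∧ l.getLast? = some t

noncomputable def distOn (G : WGraph V) (F : Finset (Sym2 V)) (s t : V) : ℝ :=
  sInf {x | ∃ l, IsWalkOn F s t l ∧ G.walkWeight l = x}

def IsWalk (G : WGraph V) (s t : V) (l : List V) : Prop := IsWalkOn G.Edge s t l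

def Reachable (G : WGraph V) (s t : V) : Prop := ∃ l, G.IsWalk s t l

noncomputable def dist (G : WGraph V) (s t : V) : ℝ := G.distOn G.Edge s t

def PosWeights (G : WGraph V) : Prop := ∀ e ∈ G.Edge, 0 < G.w e

def Unweighted (G : WGraph V) : Prop := ∀ e ∈ G.Edge, G.w e = 1

def IsExactPreserver (G : WGraph V) (F : Finset (Sym2 V)) (P : Finset (V × V)) : Prop :=
  F ⊆ G.Edge ∧ ∀ q ∈ P, (∃ l, IsWalkOn F q.1 q.2 l) ∧ G.distOn F q.1 q.2 = G.dist q.1 q.2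

end WGraph
/-- Minimum number of edges of an exact distance preserver of a directed graph. -/
noncomputable def minPresD (n : ℕ) (G : WDigraph (Fin n)) (P : Finset (Fin n × Fin n)) : ℕ :=
  sInf {k | ∃ F : Finset (Fin n × Fin n), G.IsExactPreserver F P ∧ F.card = k}

/-- Minimum number of edges of an exact distance preserver of an undirected graph. -/
noncomputable def minPresU (n : ℕ) (G : WGraph (Fin n)) (P : Finset (Fin n × Fin n)) : ℕ :=
  sInf {k | ∃ F : Finset (Sym2 (Fin n)), G.IsExactPreserver F P ∧ F.card = k}

/-- `DDP n p`: extremal size of directed distance preservers on `n` vertices, `p` demand pairs. -/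
noncomputable def DDP (n p : ℕ) : ℕ :=
  sSup {k | ∃ G : WDigraph (Fin n), G.PosWeights ∧
    ∃ P : Finset (Fin n × Fin n), P.card = p ∧ (∀ q ∈ P, G.Reachable q.1 q.2) ∧
      minPresD n G P = k}

/-- `DADP n p`: extremal size of DAG distance preservers on `n` vertices, `p` demand pairs. -/
noncomputable def DADP (n p : ℕ) : ℕ :=
  sSup {k | ∃ G : WDigraph (Fin n), G.PosWeights ∧
    (∃ f : Fin n → ℕ, ∀ e ∈ G.Edge, f e.1 < f e.2) ∧
    ∃ P : Finset (Fin n × Fin n), P.card = p ∧ (∀ q ∈ P, G.Reachable q.1 q.2) ∧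
      minPresD n G P = k}

/-- `UDP n p`: extremal size of undirected distance preservers on `n` vertices, `p` demand pairs. -/
noncomputable def UDP (n p : ℕ) : ℕ :=
  sSup {k | ∃ G : WGraph (Fin n), G.PosWeights ∧
    ∃ P : Finset (Fin n × Fin n), P.card = p ∧ (∀ q ∈ P, G.Reachable q.1 q.2) ∧
      minPresU n G P = k}

namespace EdgePath

variable {V : Type}

/-- `EdgePath.IsPath F s es t`: the edges `es` of `F`, in this order, form a walk from `s` to `t`. -/
def IsPath (F : Finset (V × V)) : V → List (V × V) → V → Prop
  | s, [], t => s = t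
  | s, e :: es, t => e.1 = s ∧ e ∈ F ∧ IsPath F e.2 es t

/-- Total weight of a list of edges. -/
def weight (w : V × V → ℝ) (es : List (V × V)) : ℝ := (es.map w).sum

/-- `es` is a walk from `s` to `t` in `F` of minimum weight. -/
def IsShortest (F : Finset (V × V)) (w : V × V → ℝ) (s t : V) (es : List (V × V)) : Prop :=
  IsPath F s es t ∧ ∀ es', IsPath F s es' t → weight w es ≤ weight w es'

variable {F F' : Finset (V × V)} {w : V × V → ℝ} {s t a b : V} {es A B B' C : List (V × V)}

@[simp] lemma weight_nil : weight w [] = 0 := rfl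

@[simp] lemma weight_cons (e : V × V) : weight w (e :: es) = w e + weight w es := by
  simp [weight]

@[simp] lemma weight_append : weight w (A ++ B) = weight w A + weight w B := by
  simp [weight]

lemma isPath_append : IsPath F s (A ++ B) t ↔ ∃ m, IsPath F s A m ∧ IsPath F m B t := by
  induction A generalizing s with
  | nil => simp [IsPath]
  | cons e A ih => simp [IsPath, ih, and_assoc]

lemma IsPath.append (hA : IsPath F s A a) (hB : IsPath F a B t) : IsPath F s (A ++ B) t :=
  isPath_append.2 ⟨a, hA, hB⟩

lemma isPath_append_cons {e : V × V} :
    IsPath F s (A ++ e :: B) t ↔ IsPath F s A e.1 ∧ e ∈ F ∧ IsPath F e.2 B t := by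
  simp only [isPath_append, IsPath]
  constructor
  · rintro ⟨m, h1, rfl, h2, h3⟩
    exact ⟨h1, h2, h3⟩
  · rintro ⟨h1, h2, h3⟩
    exact ⟨_, h1, rfl, h2, h3⟩

lemma isPath_concat {e : V × V} :
    IsPath F s (A ++ [e]) t ↔ IsPath F s A e.1 ∧ e ∈ F ∧ e.2 = t := by
  simp [isPath_append_cons, IsPath]

lemma IsPath.mem (h : IsPath F s es t) : ∀ e ∈ es, e ∈ F := by
  induction es generalizing s with
  | nil => simp
  | cons e es ih =>
    obtain ⟨-, he, h⟩ := h
    simpa [he] using ih h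

lemma IsPath.of_mem (h : IsPath F s es t) (hF : ∀ e ∈ es, e ∈ F') : IsPath F' s es t := by
  induction es generalizing s with
  | nil => exact h
  | cons e es ih =>
    exact ⟨h.1, hF e (by simp), ih h.2.2 fun e' he' => hF e' (by simp [he'])⟩

lemma IsPath.mono (hF : F ⊆ F') (h : IsPath F s es t) : IsPath F' s es t :=
  h.of_mem fun e he => hF (h.mem e he)

lemma IsPath.weight_nonneg (hw : ∀ e ∈ F, 0 < w e) (h : IsPath F s es t) : 0 ≤ weight w es := by
  refine List.sum_nonneg fun x hx => ?_
  obtain ⟨e, he, rfl⟩ := List.mem_map.1 hx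
  exact (hw e (h.mem e he)).le

lemma IsPath.exists_isShortest [Finite V] (hw : ∀ e ∈ F, 0 < w e) (h : IsPath F s es t) :
    ∃ es', IsShortest F w s t es' := by
  obtain ⟨δ, hδ, hF⟩ : ∃ δ > 0, ∀ e ∈ F, δ ≤ w e := by
    rcases F.eq_empty_or_nonempty with rfl | hne
    · exact ⟨1, one_pos, by simp⟩
    · obtain ⟨e, he, hmin⟩ := F.exists_min_image w hne
      exact ⟨w e, hw e he, hmin⟩
  have hlen : ∀ es' : List (V × V), (∀ e ∈ es', e ∈ F) → es'.length * δ ≤ weight w es' := by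
    intro es' hes'
    induction es' with
    | nil => simp
    | cons e es' ih =>
      have h1 := hF e (hes' e (by simp))
      have h2 := ih fun e' he' => hes' e' (by simp [he'])
      push_cast [List.length_cons, weight_cons]
      linarith
  let S : Set (List (V × V)) := {es' | IsPath F s es' t ∧ weight w es' ≤ weight w es}
  have hfin : S.Finite := by
    refine (List.finite_length_le (V × V) ⌊weight w es / δ⌋₊).subset fun es' hes' => ?_
    refine Nat.le_floor ?_
    rw [le_div_iff₀ hδ]
    exact (hlen es' hes'.1.mem).trans hes'.2
  obtain ⟨m, hm, hmin⟩ := S.exists_min_image (weight w) hfin ⟨es, h, le_rfl⟩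
  refine ⟨m, hm.1, fun es' hes' => ?_⟩
  rcases le_total (weight w es') (weight w es) with hle | hle
  · exact hmin es' ⟨hes', hle⟩
  · exact hm.2.trans hle

lemma IsShortest.weight_eq (hA : IsShortest F w s t A) (hB : IsShortest F w s t B) :
    weight w A = weight w B :=
  le_antisymm (hA.2 _ hB.1) (hB.2 _ hA.1)

lemma IsShortest.replace (h : IsShortest F w s t (A ++ B ++ C)) (hA : IsPath F s A a)
    (hB' : IsPath F a B' b) (hC : IsPath F b C t) (hle : weight w B' ≤ weight w B) :
    IsShortest F w s t (A ++ B' ++ C) := by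
  refine ⟨(hA.append hB').append hC, fun es' hes' => le_trans ?_ (h.2 es' hes')⟩
  simp only [weight_append]
  linarith

lemma IsShortest.middle (h : IsShortest F w s t (A ++ B ++ C)) (hA : IsPath F s A a)
    (hB : IsPath F a B b) (hC : IsPath F b C t) : IsShortest F w a b B := by
  refine ⟨hB, fun es' hes' => ?_⟩
  have := h.2 _ ((hA.append hes').append hC)
  simp only [weight_append] at this
  linarith

lemma IsShortest.left (h : IsShortest F w s t (A ++ B)) (hA : IsPath F s A a)
    (hB : IsPath F a B t) : IsShortest F w s a A :=
  IsShortest.middle (A := []) (by simpa using h) rfl hA hB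

lemma IsShortest.right (h : IsShortest F w s t (A ++ B)) (hA : IsPath F s A a)
    (hB : IsPath F a B t) : IsShortest F w a t B :=
  IsShortest.middle (C := []) (by simpa using h) hA hB rfl

lemma IsShortest.eq_nil (hw : ∀ e ∈ F, 0 < w e) (h : IsShortest F w s s es) : es = [] := by
  cases es with
  | nil => rfl
  | cons e es =>
    have h1 := h.2 [] rfl
    have h2 := hw e (h.1.mem e (by simp))
    have h3 := h.1.2.2.weight_nonneg hw
    simp only [weight_cons, weight_nil] at h1
    linarith

lemma IsShortest.nodup_snd (hw : ∀ e ∈ F, 0 < w e) (h : IsShortest F w s t es) :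
    (es.map Prod.snd).Nodup := by
  induction es generalizing s with
  | nil => simp
  | cons e es ih =>
    have he : IsPath F s [e] e.2 := ⟨h.1.1, h.1.2.1, rfl⟩
    have ht : IsShortest F w e.2 t es := IsShortest.right (A := [e]) h he h.1.2.2
    refine List.nodup_cons.2 ⟨fun hmem => ?_, ih ht⟩
    obtain ⟨e', he', heq⟩ := List.mem_map.1 hmem
    obtain ⟨X, Y, rfl⟩ := List.append_of_mem he'
    have hp := isPath_append_cons.1 ht.1
    have hX : IsPath F e.2 (X ++ [e']) e.2 := isPath_concat.2 ⟨hp.1, hp.2.1, heq⟩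
    have := IsShortest.eq_nil hw (IsShortest.left (A := X ++ [e']) (B := Y) (by simpa using ht) hX
      (heq ▸ hp.2.2))
    simp at this

lemma IsShortest.nodup_fst (hw : ∀ e ∈ F, 0 < w e) (h : IsShortest F w s t es) :
    (es.map Prod.fst).Nodup := by
  induction es generalizing s with
  | nil => simp
  | cons e es ih =>
    have he : IsPath F s [e] e.2 := ⟨h.1.1, h.1.2.1, rfl⟩
    have ht : IsShortest F w e.2 t es := IsShortest.right (A := [e]) h he h.1.2.2
    refine List.nodup_cons.2 ⟨fun hmem => ?_, ih ht⟩
    obtain ⟨e', he', heq⟩ := List.mem_map.1 hmem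
    obtain ⟨X, Y, rfl⟩ := List.append_of_mem he'
    have hp := isPath_append_cons.1 ht.1
    have hs : e'.1 = s := heq.trans h.1.1
    have hX : IsPath F s (e :: X) s := ⟨h.1.1, h.1.2.1, hs ▸ hp.1⟩
    have := IsShortest.eq_nil hw (IsShortest.left (A := e :: X) (B := e' :: Y) h hX
      ⟨hs, hp.2.1, hp.2.2⟩)
    simp at this

lemma IsShortest.eq_of_snd_eq (hw : ∀ e ∈ F, 0 < w e) (h : IsShortest F w s t es) {e e' : V × V}
    (he : e ∈ es) (he' : e' ∈ es) (heq : e.2 = e'.2) : e = e' :=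
  List.inj_on_of_nodup_map (h.nodup_snd hw) he he' heq

lemma IsShortest.eq_of_fst_eq (hw : ∀ e ∈ F, 0 < w e) (h : IsShortest F w s t es) {e e' : V × V}
    (he : e ∈ es) (he' : e' ∈ es) (heq : e.1 = e'.1) : e = e' :=
  List.inj_on_of_nodup_map (h.nodup_fst hw) he he' heq

end EdgePath

open EdgePath

namespace WDigraph

variable {V : Type} {G : WDigraph V} {F P : Finset (V × V)} {s t : V} {es : List (V × V)}

lemma zip_tail_of_isPath (h : IsPath F s es t) :
    (s :: es.map Prod.snd).zip (es.map Prod.snd) = es := by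
  induction es generalizing s with
  | nil => simp
  | cons e es ih =>
    obtain ⟨rfl, -, h⟩ := h
    simp [ih h]

lemma walkWeight_of_isPath (h : IsPath F s es t) :
    G.walkWeight (s :: es.map Prod.snd) = weight G.w es := by
  simp [walkWeight, weight, zip_tail_of_isPath h]

lemma isWalkOn_of_isPath (h : IsPath F s es t) : IsWalkOn F s t (s :: es.map Prod.snd) := by
  induction es generalizing s with
  | nil =>
    obtain rfl : s = t := h
    exact ⟨List.isChain_singleton _, rfl, rfl⟩
  | cons e es ih =>
    obtain ⟨rfl, he, h⟩ := h
    obtain ⟨h1, h2, h3⟩ := ih h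
    refine ⟨?_, rfl, ?_⟩
    · simpa [List.Chain'] using And.intro he h1
    · simpa using h3

lemma exists_isPath_of_isWalkOn {l : List V} (h : IsWalkOn F s t l) :
    ∃ es, IsPath F s es t ∧ l = s :: es.map Prod.snd := by
  induction l generalizing s with
  | nil => simp [IsWalkOn] at h
  | cons x l ih =>
    obtain ⟨h1, h2, h3⟩ := h
    obtain rfl : x = s := by simpa using h2
    cases l with
    | nil =>
      obtain rfl : x = t := by simpa using h3
      exact ⟨[], rfl, rfl⟩
    | cons y l =>
      have h1' := List.isChain_cons_cons.1 h1
      obtain ⟨es, hes, heq⟩ := ih (s := y) ⟨h1'.2, rfl, by simpa using h3⟩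
      exact ⟨(x, y) :: es, ⟨rfl, h1'.1, hes⟩, by simpa using heq⟩

lemma reachableOn_iff : ReachableOn F s t ↔ ∃ es, IsPath F s es t :=
  ⟨fun ⟨_, h⟩ => (exists_isPath_of_isWalkOn h).imp fun _ h => h.1,
    fun ⟨_, h⟩ => ⟨_, isWalkOn_of_isPath h⟩⟩

lemma distOn_eq_weight (h : IsShortest F G.w s t es) : G.distOn F s t = weight G.w es := by
  refine IsLeast.csInf_eq ⟨⟨_, isWalkOn_of_isPath h.1, walkWeight_of_isPath h.1⟩, ?_⟩
  rintro x ⟨l, hl, rfl⟩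
  obtain ⟨es', hes', rfl⟩ := exists_isPath_of_isWalkOn hl
  rw [walkWeight_of_isPath hes']
  exact h.2 _ hes'

lemma isExactPreserver_iff [Finite V] (hG : G.PosWeights) :
    G.IsExactPreserver F P ↔ F ⊆ G.Edge ∧ ∀ q ∈ P, ∃ es, IsPath F q.1 es q.2 ∧
      IsShortest G.Edge G.w q.1 q.2 es := by
  refine and_congr_right fun hF => forall₂_congr fun q hq => ?_
  have hwF : ∀ e ∈ F, 0 < G.w e := fun e he => hG e (hF he)
  constructor
  · rintro ⟨hr, hd⟩
    obtain ⟨es, hes⟩ := reachableOn_iff.1 hr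
    obtain ⟨es₁, hs₁⟩ := hes.exists_isShortest hwF
    obtain ⟨es₂, hs₂⟩ := (hes.mono hF).exists_isShortest hG
    rw [WDigraph.dist, distOn_eq_weight hs₁, distOn_eq_weight hs₂] at hd
    exact ⟨es₁, hs₁.1, hs₁.1.mono hF, fun es' hes' => hd ▸ hs₂.2 es' hes'⟩
  · rintro ⟨es, hes, hs⟩
    refine ⟨reachableOn_iff.2 ⟨es, hes⟩, ?_⟩
    rw [WDigraph.dist, distOn_eq_weight hs,
      distOn_eq_weight ⟨hes, fun es' hes' => hs.2 es' (hes'.mono hF)⟩]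

end WDigraph

section Extremal

variable {n p : ℕ}

lemma exists_preserver_card_eq_minPresD {G : WDigraph (Fin n)} {P : Finset (Fin n × Fin n)}
    (hP : ∀ q ∈ P, G.Reachable q.1 q.2) :
    ∃ F, G.IsExactPreserver F P ∧ F.card = minPresD n G P :=
  Nat.sInf_mem (s := {k | ∃ F, G.IsExactPreserver F P ∧ F.card = k})
    ⟨_, G.Edge, ⟨subset_rfl, fun q hq => ⟨hP q hq, rfl⟩⟩, rfl⟩

lemma minPresD_le_card {G : WDigraph (Fin n)} {P F : Finset (Fin n × Fin n)}
    (hF : G.IsExactPreserver F P) : minPresD n G P ≤ F.card :=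
  Nat.sInf_le ⟨F, hF, rfl⟩

lemma minPresD_le_mul {G : WDigraph (Fin n)} {P : Finset (Fin n × Fin n)}
    (hP : ∀ q ∈ P, G.Reachable q.1 q.2) : minPresD n G P ≤ n * n := by
  obtain ⟨F, -, hF⟩ := exists_preserver_card_eq_minPresD hP
  rw [← hF]
  simpa using F.card_le_univ

lemma minPresD_le_DADP {G : WDigraph (Fin n)} {P : Finset (Fin n × Fin n)} (hG : G.PosWeights)
    (f : Fin n → ℕ) (hf : ∀ e ∈ G.Edge, f e.1 < f e.2) (hp : P.card = p)
    (hP : ∀ q ∈ P, G.Reachable q.1 q.2) : minPresD n G P ≤ DADP n p := by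
  refine le_csSup ⟨n * n, ?_⟩ ⟨G, hG, ⟨f, hf⟩, P, hp, hP, rfl⟩
  rintro k ⟨G, -, -, P, -, hP, rfl⟩
  exact minPresD_le_mul hP

lemma exists_minPresD_eq_DDP (h : DDP n p ≠ 0) :
    ∃ G : WDigraph (Fin n), G.PosWeights ∧ ∃ P : Finset (Fin n × Fin n), P.card = p ∧
      (∀ q ∈ P, G.Reachable q.1 q.2) ∧ minPresD n G P = DDP n p := by
  refine Nat.sSup_mem (s := {k | ∃ G : WDigraph (Fin n), G.PosWeights ∧
    ∃ P : Finset (Fin n × Fin n), P.card = p ∧ (∀ q ∈ P, G.Reachable q.1 q.2) ∧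
      minPresD n G P = k}) (Set.nonempty_iff_ne_empty.2 fun hempty => h ?_) ⟨n * n, ?_⟩
  · rw [DDP, hempty, csSup_empty, bot_eq_zero]
  · rintro k ⟨G, -, P, -, hP, rfl⟩
    exact minPresD_le_mul hP

end Extremal

/-- Every edge `e` of `H` lies on all shortest walks for the demand pair `o e` of `P`. -/
def IsOwnership {V : Type} (H : Finset (V × V)) (w : V × V → ℝ) (P : Finset (V × V))
    (o : V × V → V × V) : Prop :=
  ∀ e ∈ H, o e ∈ P ∧ ∀ es, IsShortest H w (o e).1 (o e).2 es → e ∈ es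

lemma exists_isOwnership_of_DDP_ne_zero {n p : ℕ} (h : DDP n p ≠ 0) :
    ∃ (H : Finset (Fin n × Fin n)) (w : Fin n × Fin n → ℝ) (P : Finset (Fin n × Fin n))
      (o : Fin n × Fin n → Fin n × Fin n), H.card = DDP n p ∧ P.card = p ∧ (∀ e ∈ H, 0 < w e) ∧
      (∀ q ∈ P, ∃ es, IsPath H q.1 es q.2) ∧ IsOwnership H w P o := by
  obtain ⟨G, hG, P, hp, hP, hmin⟩ := exists_minPresD_eq_DDP h
  obtain ⟨H, hH, hcard⟩ := exists_preserver_card_eq_minPresD hP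
  have hH' := (WDigraph.isExactPreserver_iff hG).1 hH
  have key : ∀ e ∈ H, ∃ q ∈ P, ∀ es, IsShortest H G.w q.1 q.2 es → e ∈ es := by
    intro e he
    by_contra! hcon
    have : G.IsExactPreserver (H.erase e) P := by
      refine (WDigraph.isExactPreserver_iff hG).2
        ⟨(H.erase_subset e).trans hH'.1, fun q hq => ?_⟩
      obtain ⟨es, hes, hmem⟩ := hcon q hq
      obtain ⟨es', hes', hs⟩ := hH'.2 q hq
      refine ⟨es, hes.1.of_mem fun e' he' => Finset.mem_erase.2
        ⟨fun heq => hmem (heq ▸ he'), hes.1.mem e' he'⟩, hes.1.mono hH'.1, fun l hl => ?_⟩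
      exact (hes.2 es' hes').trans (hs.2 l hl)
    have h1 := minPresD_le_card this
    have h2 := Finset.card_erase_lt_of_mem he
    omega
  choose! o ho using key
  exact ⟨H, G.w, P, o, hcard.trans hmin, hp, fun e he => hG e (hH'.1 he),
    fun q hq => (hH'.2 q hq).imp fun _ h => h.1, ho⟩

section Ownership

variable {V : Type} {H P : Finset (V × V)} {w : V × V → ℝ} {o : V × V → V × V}

/-- Two edges with a common head, each on the part after `v` of a shortest walk of its owner,
coincide. -/
lemma IsOwnership.eq_of_snd_eq (ho : IsOwnership H w P o) (hw : ∀ e ∈ H, 0 < w e)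
    {v : V} {e e' : V × V} {A C A' C' : List (V × V)} (he' : e' ∈ H)
    (h : IsShortest H w (o e).1 (o e).2 (A ++ C)) (hA : IsPath H (o e).1 A v)
    (hC : IsPath H v C (o e).2) (h' : IsShortest H w (o e').1 (o e').2 (A' ++ C'))
    (hA' : IsPath H (o e').1 A' v) (hC' : IsPath H v C' (o e').2)
    (hm : e ∈ C) (hm' : e' ∈ C') (heq : e.2 = e'.2) : e = e' := by
  obtain ⟨X, Y, rfl⟩ := List.append_of_mem hm
  obtain ⟨X', Y', rfl⟩ := List.append_of_mem hm'
  have p1 := isPath_append_cons.1 hC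
  have p2 := isPath_append_cons.1 hC'
  have q1 : IsPath H v (X ++ [e]) e'.2 := isPath_concat.2 ⟨p1.1, p1.2.1, heq⟩
  have q2 : IsPath H v (X' ++ [e']) e'.2 := isPath_concat.2 ⟨p2.1, p2.2.1, rfl⟩
  have s1 : IsShortest H w v e'.2 (X ++ [e]) :=
    IsShortest.middle (C := Y) (by simpa using h) hA q1 (heq ▸ p1.2.2)
  have s3 := IsShortest.replace (B := X' ++ [e']) (C := Y') (by simpa using h') hA' q1 p2.2.2
    (s1.2 _ q2)
  exact s3.eq_of_snd_eq hw (by simp) ((ho e' he').2 _ s3) heq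

/-- Two edges with a common tail, each on the part before `v` of a shortest walk of its owner,
coincide. -/
lemma IsOwnership.eq_of_fst_eq (ho : IsOwnership H w P o) (hw : ∀ e ∈ H, 0 < w e)
    {v : V} {e e' : V × V} {A C A' C' : List (V × V)} (he' : e' ∈ H)
    (h : IsShortest H w (o e).1 (o e).2 (A ++ C)) (hA : IsPath H (o e).1 A v)
    (hC : IsPath H v C (o e).2) (h' : IsShortest H w (o e').1 (o e').2 (A' ++ C'))
    (hA' : IsPath H (o e').1 A' v) (hC' : IsPath H v C' (o e').2)
    (hm : e ∈ A) (hm' : e' ∈ A') (heq : e.1 = e'.1) : e = e' := by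
  obtain ⟨X, Y, rfl⟩ := List.append_of_mem hm
  obtain ⟨X', Y', rfl⟩ := List.append_of_mem hm'
  have p1 := isPath_append_cons.1 hA
  have p2 := isPath_append_cons.1 hA'
  have q1 : IsPath H e'.1 (e :: Y) v := ⟨heq, p1.2⟩
  have q2 : IsPath H e'.1 (e' :: Y') v := ⟨rfl, p2.2⟩
  have s1 : IsShortest H w e'.1 v (e :: Y) :=
    IsShortest.middle (A := X) (C := C) (by simpa using h) (heq ▸ p1.1) q1 hC
  have s3 := IsShortest.replace (A := X') (B := e' :: Y') (C := C') (by simpa using h') p2.1 q1 hC'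
    (s1.2 _ q2)
  exact s3.eq_of_fst_eq hw (by simp) ((ho e' he').2 _ s3) heq

open Classical in
lemma IsOwnership.card_filter_le [Fintype V] (ho : IsOwnership H w P o) (hw : ∀ e ∈ H, 0 < w e)
    (π : V × V → List (V × V)) (hπ : ∀ q ∈ P, IsShortest H w q.1 q.2 (π q)) (v : V) :
    (H.filter fun e => v ∈ (π (o e)).map Prod.snd).card ≤ 2 * Fintype.card V := by
  let S (K : List (V × V) → List (V × V) → List (V × V)) : Finset (V × V) :=
    H.filter fun e => ∃ A C, π (o e) = A ++ C ∧ IsPath H (o e).1 A v ∧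
      IsPath H v C (o e).2 ∧ e ∈ K A C
  have hsub : (H.filter fun e => v ∈ (π (o e)).map Prod.snd) ⊆
      S (fun A _ => A) ∪ S (fun _ C => C) := by
    intro e he
    obtain ⟨heH, hv⟩ := Finset.mem_filter.1 he
    obtain ⟨f, hf, rfl⟩ := List.mem_map.1 hv
    obtain ⟨X, Y, hXY⟩ := List.append_of_mem hf
    have hs := hπ _ (ho e heH).1
    have hp := isPath_append_cons.1 (hXY ▸ hs.1)
    have hmem : e ∈ (X ++ [f]) ++ Y := by simpa [hXY] using (ho e heH).2 _ hs
    have hX : IsPath H (o e).1 (X ++ [f]) f.2 := isPath_concat.2 ⟨hp.1, hp.2.1, rfl⟩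
    rcases List.mem_append.1 hmem with h | h
    · exact Finset.mem_union_left _ (Finset.mem_filter.2
        ⟨heH, X ++ [f], Y, by simpa using hXY, hX, hp.2.2, h⟩)
    · exact Finset.mem_union_right _ (Finset.mem_filter.2
        ⟨heH, X ++ [f], Y, by simpa using hXY, hX, hp.2.2, h⟩)
  have h1 : (S fun A _ => A).card ≤ Fintype.card V := by
    refine Finset.card_le_card_of_injOn (t := Finset.univ) Prod.fst (by simp) ?_
    intro e he e' he' heq
    obtain ⟨heH, A, C, hAC, hA, hC, hm⟩ := Finset.mem_filter.1 he
    obtain ⟨heH', A', C', hAC', hA', hC', hm'⟩ := Finset.mem_filter.1 he'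
    exact ho.eq_of_fst_eq hw heH' (hAC ▸ hπ _ (ho e heH).1) hA hC (hAC' ▸ hπ _ (ho e' heH').1)
      hA' hC' hm hm' heq
  have h2 : (S fun _ C => C).card ≤ Fintype.card V := by
    refine Finset.card_le_card_of_injOn (t := Finset.univ) Prod.snd (by simp) ?_
    intro e he e' he' heq
    obtain ⟨heH, A, C, hAC, hA, hC, hm⟩ := Finset.mem_filter.1 he
    obtain ⟨heH', A', C', hAC', hA', hC', hm'⟩ := Finset.mem_filter.1 he'
    exact ho.eq_of_snd_eq hw heH' (hAC ▸ hπ _ (ho e heH).1) hA hC (hAC' ▸ hπ _ (ho e' heH').1)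
      hA' hC' hm hm' heq
  have h3 := (Finset.card_le_card hsub).trans (Finset.card_union_le _ _)
  omega

lemma exists_isShortest_family [Finite V] (hw : ∀ e ∈ H, 0 < w e)
    (hP : ∀ q ∈ P, ∃ es, IsPath H q.1 es q.2) :
    ∃ π : V × V → List (V × V), ∀ q ∈ P, IsShortest H w q.1 q.2 (π q) := by
  have : ∀ q ∈ P, ∃ es, IsShortest H w q.1 q.2 es := fun q hq =>
    let ⟨_, h⟩ := hP q hq
    h.exists_isShortest hw
  choose! π hπ using this
  exact ⟨π, hπ⟩

/-- A minimal preserver has at most `√2 · n · √p` edges. -/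
lemma IsOwnership.card_sq_le [Fintype V] (ho : IsOwnership H w P o) (hw : ∀ e ∈ H, 0 < w e)
    (hP : ∀ q ∈ P, ∃ es, IsPath H q.1 es q.2) :
    H.card ^ 2 ≤ 2 * Fintype.card V ^ 2 * P.card := by
  classical
  obtain ⟨π, hπ⟩ := exists_isShortest_family hw hP
  have h1 : ∑ e ∈ H, (π (o e)).length ≤ 2 * Fintype.card V ^ 2 := by
    calc ∑ e ∈ H, (π (o e)).length
        = ∑ e ∈ H, (Finset.univ.filter fun v => v ∈ (π (o e)).map Prod.snd).card := by
          refine Finset.sum_congr rfl fun e he => ?_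
          have hnd := (hπ _ (ho e he).1).nodup_snd hw
          rw [← List.length_map (f := Prod.snd), ← List.toFinset_card_of_nodup hnd]
          congr 1
          ext v
          simp
      _ = ∑ v : V, (H.filter fun e => v ∈ (π (o e)).map Prod.snd).card :=
          Finset.sum_card_bipartiteAbove_eq_sum_card_bipartiteBelow
            (fun e v => v ∈ (π (o e)).map Prod.snd)
      _ ≤ ∑ _v : V, 2 * Fintype.card V := Finset.sum_le_sum fun v _ => ho.card_filter_le hw π hπ v
      _ = 2 * Fintype.card V ^ 2 := by simp; ring
  have hmaps : ∀ e ∈ H, o e ∈ P := fun e he => (ho e he).1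
  have h2 : ∑ q ∈ P, (H.filter fun e => o e = q).card ^ 2 ≤ ∑ e ∈ H, (π (o e)).length := by
    rw [← Finset.sum_fiberwise_of_maps_to hmaps]
    refine Finset.sum_le_sum fun q hq => ?_
    rw [sq, ← smul_eq_mul, ← Finset.sum_const]
    refine Finset.sum_le_sum fun e he => ?_
    rw [(Finset.mem_filter.1 he).2]
    refine le_trans (Finset.card_le_card fun e' he' => ?_) (π q).toFinset_card_le
    obtain ⟨heH, rfl⟩ := Finset.mem_filter.1 he'
    exact List.mem_toFinset.2 ((ho e' heH).2 _ (hπ _ hq))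
  have h3 : H.card ^ 2 ≤ P.card * ∑ q ∈ P, (H.filter fun e => o e = q).card ^ 2 := by
    rw [Finset.card_eq_sum_card_fiberwise hmaps]
    exact sq_sum_le_card_mul_sum_sq
  calc _ ≤ _ := h3
    _ ≤ P.card * (2 * Fintype.card V ^ 2) := Nat.mul_le_mul_left _ (h2.trans h1)
    _ = _ := by ring

end Ownership

lemma Finset.sum_le_of_forall_card_le {α : Type*} {k : ℕ} (hk : 0 < k) {f : α → ℝ} {M : ℝ}
    (T : Finset α) (h : ∀ S ⊆ T, S.card ≤ k → ∑ e ∈ S, f e ≤ M) :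
    ∑ e ∈ T, f e ≤ M * (T.card / k + 1) := by
  classical
  have hM : 0 ≤ M := by simpa using h ∅ (by simp) (by simp)
  have hk' : (0 : ℝ) < k := by exact_mod_cast hk
  induction hT : T.card using Nat.strong_induction_on generalizing T with
  | _ c ih =>
    rcases le_or_gt T.card k with hle | hlt
    · refine (h T subset_rfl hle).trans (le_mul_of_one_le_right hM ?_)
      have : (0 : ℝ) ≤ c / k := by positivity
      linarith
    · obtain ⟨S, hST, hS⟩ := Finset.exists_subset_card_eq hlt.le
      have h1 := h S hST hS.le
      have hc := Finset.card_sdiff_add_card_eq_card hST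
      have h2 := ih (T \ S).card (by omega) (T \ S)
        (fun S' hS' => h S' (hS'.trans Finset.sdiff_subset)) rfl
      have h3 : ((T \ S).card : ℝ) / k + 1 = c / k := by
        have : ((T \ S).card : ℝ) + k = c := by
          rw [← hT, ← hc, hS]
          push_cast
          ring
        rw [← this]
        field_simp
      rw [h3] at h2
      rw [← Finset.sum_sdiff hST]
      linarith

section Ownership

variable {V : Type} {H P : Finset (V × V)} {w : V × V → ℝ} {o : V × V → V × V}

/-- Some demand pair owns at most `k` edges whose heads have large total in-degree. -/
lemma IsOwnership.exists_large_indegree [Fintype V] [DecidableEq V] (ho : IsOwnership H w P o)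
    (hH : H.Nonempty) {k : ℕ} (hk : H.card ≤ k * P.card) :
    ∃ q ∈ P, ∃ S ⊆ H.filter fun e => o e = q, S.card ≤ k ∧
      (H.card : ℝ) ^ 2 ≤ 3 * Fintype.card V * P.card *
        ∑ e ∈ S, ((H.filter fun e' => e'.2 = e.2).card : ℝ) := by
  have hD : 0 < H.card := hH.card_pos
  obtain ⟨e₀, he₀⟩ := hH
  have hp : 0 < P.card := Finset.card_pos.2 ⟨_, (ho e₀ he₀).1⟩
  have hn : 0 < Fintype.card V := Fintype.card_pos_iff.2 ⟨e₀.1⟩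
  have hk0 : 0 < k := Nat.pos_of_ne_zero fun h => by rw [h, zero_mul] at hk; omega
  have hD' : (0 : ℝ) < H.card := by exact_mod_cast hD
  have hp' : (0 : ℝ) < P.card := by exact_mod_cast hp
  have hn' : (0 : ℝ) < Fintype.card V := by exact_mod_cast hn
  have hk' : (0 : ℝ) < k := by exact_mod_cast hk0
  have hkr : (H.card : ℝ) ≤ k * P.card := by exact_mod_cast hk
  by_contra! hcon
  set N : ℝ := 3 * Fintype.card V * P.card with hN
  have hN0 : 0 < N := by positivity
  have hmaps : ∀ e ∈ H, o e ∈ P := fun e he => (ho e he).1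
  let d : V → ℝ := fun v => ((H.filter fun e' => e'.2 = v).card : ℝ)
  have hupper : ∑ e ∈ H, d e.2 ≤ (H.card : ℝ) ^ 2 / N * (2 * P.card) := by
    calc ∑ e ∈ H, d e.2 = ∑ q ∈ P, ∑ e ∈ H with o e = q, d e.2 :=
          (Finset.sum_fiberwise_of_maps_to hmaps _).symm
      _ ≤ ∑ q ∈ P, (H.card : ℝ) ^ 2 / N * ((H.filter fun e => o e = q).card / k + 1) := by
          refine Finset.sum_le_sum fun q hq =>
            Finset.sum_le_of_forall_card_le hk0 _ fun S hS hSk => ?_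
          rw [le_div_iff₀ hN0, mul_comm]
          exact (hcon q hq S hS hSk).le
      _ = (H.card : ℝ) ^ 2 / N * (H.card / k + P.card) := by
          rw [← Finset.mul_sum, Finset.sum_add_distrib, ← Finset.sum_div, ← Nat.cast_sum,
            ← Finset.card_eq_sum_card_fiberwise hmaps]
          simp
      _ ≤ _ := by
          have : (H.card : ℝ) / k ≤ P.card := by
            rw [div_le_iff₀ hk']
            linarith
          gcongr
          linarith
  have hlower : (H.card : ℝ) ^ 2 ≤ Fintype.card V * ∑ e ∈ H, d e.2 := by
    have h1 : ∑ e ∈ H, d e.2 = ∑ v : V, d v ^ 2 := by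
      rw [← Finset.sum_fiberwise_of_maps_to (g := Prod.snd) (t := Finset.univ) (by simp)]
      refine Finset.sum_congr rfl fun v _ => ?_
      rw [Finset.sum_congr rfl (g := fun _ => d v)
        (fun e he => by rw [(Finset.mem_filter.1 he).2])]
      simp [d, sq]
    have h2 : (H.card : ℝ) = ∑ v : V, d v := by
      rw [Finset.card_eq_sum_card_fiberwise (f := Prod.snd) (t := Finset.univ) (by simp)]
      push_cast
      rfl
    rw [h1, h2]
    exact sq_sum_le_card_mul_sum_sq
  have h3 := hlower.trans (mul_le_mul_of_nonneg_left hupper hn'.le)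
  have h4 : (Fintype.card V : ℝ) * ((H.card : ℝ) ^ 2 / N * (2 * P.card)) =
      2 / 3 * (H.card : ℝ) ^ 2 := by
    rw [hN]
    field_simp
  rw [h4] at h3
  nlinarith

end Ownership

section Embedding

variable {V : Type} {U : Finset V} {E Q : Finset (V × V)} {w : V × V → ℝ}

/-- A DAG on few vertices with at most `p` demand pairs has a preserver with at most `DADP m p`
edges, if `m` leaves room for `p` further demand pairs on new vertices. -/
lemma exists_preserver_le_DADP {m p r : ℕ} (hE : ∀ e ∈ E, e.1 ∈ U ∧ e.2 ∈ U)
    (hw : ∀ e ∈ E, 0 < w e) {f : V → ℕ} (hf : ∀ e ∈ E, f e.1 < f e.2)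
    (hQU : ∀ q ∈ Q, q.1 ∈ U ∧ q.2 ∈ U) (hQ : ∀ q ∈ Q, ∃ es, IsPath E q.1 es q.2)
    (hQp : Q.card ≤ p) (hm : U.card + 2 * r ≤ m) (hp : p ≤ r * r) :
    ∃ F ⊆ E, F.card ≤ DADP m p ∧
      ∀ q ∈ Q, ∃ es, IsPath F q.1 es q.2 ∧ IsShortest E w q.1 q.2 es := by
  classical
  rcases Q.eq_empty_or_nonempty with rfl | ⟨q₀, hq₀⟩
  · exact ⟨∅, by simp, by simp, by simp⟩
  have : Nonempty V := ⟨q₀.1⟩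
  have hU : 0 < U.card := Finset.card_pos.2 ⟨_, (hQU q₀ hq₀).1⟩
  obtain ⟨j, hjU, hj⟩ : ∃ j : V → Fin m, (∀ v ∈ U, (j v : ℕ) < U.card) ∧ Set.InjOn j U := by
    refine ⟨fun v => if h : v ∈ U then ⟨U.equivFin ⟨v, h⟩, by omega⟩ else ⟨0, by omega⟩,
      fun v hv => by simp [hv], fun v hv v' hv' heq => ?_⟩
    rw [Finset.mem_coe] at hv hv'
    simpa [hv, hv', Fin.ext_iff, ← Fin.ext_iff] using heq
  let g := Function.invFunOn j U
  have hg : ∀ v ∈ U, g (j v) = v := fun v hv => hj.leftInvOn_invFunOn hv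
  let J : V × V → Fin m × Fin m := fun e => (j e.1, j e.2)
  let K : Fin m × Fin m → V × V := fun e => (g e.1, g e.2)
  have hKJ : ∀ e : V × V, e.1 ∈ U → e.2 ∈ U → K (J e) = e := fun e h1 h2 =>
    Prod.ext (hg _ h1) (hg _ h2)
  let extra : Fin r × Fin r → Fin m × Fin m := fun x =>
    (⟨U.card + x.1, by omega⟩, ⟨U.card + r + x.2, by omega⟩)
  have hextra : Function.Injective extra := by
    rintro ⟨a, b⟩ ⟨a', b'⟩ h
    simp only [extra, Prod.mk.injEq, Fin.mk.injEq] at h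
    ext <;> simp <;> omega
  let E₂ : Finset (Fin m × Fin m) := Finset.univ.image extra
  have hE₂ : E₂.card = r * r := by
    rw [Finset.card_image_of_injective _ hextra]
    simp
  have hE₂mem : ∀ e ∈ E₂, U.card ≤ e.1 ∧ e.1 < e.2 := by
    intro e he
    obtain ⟨x, -, rfl⟩ := Finset.mem_image.1 he
    simp only [extra, Fin.lt_def]
    omega
  let G : WDigraph (Fin m) :=
    ⟨E.image J ∪ E₂, fun e => if (e.1 : ℕ) < U.card then w (K e) else 1⟩
  have hGw : ∀ e : V × V, e.1 ∈ U → e.2 ∈ U → G.w (J e) = w e := by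
    intro e h1 h2
    have : ((J e).1 : ℕ) < U.card := hjU _ h1
    simp only [G, this, if_true, hKJ e h1 h2]
  have hG : G.PosWeights := by
    intro e he
    rcases Finset.mem_union.1 he with h | h
    · obtain ⟨e', he', rfl⟩ := Finset.mem_image.1 h
      rw [hGw e' (hE e' he').1 (hE e' he').2]
      exact hw e' he'
    · simp [G, not_lt.2 (hE₂mem e h).1]
  let ρ : Fin m → ℕ := fun i => if (i : ℕ) < U.card then f (g i) else i
  have hrank : ∀ e ∈ G.Edge, ρ e.1 < ρ e.2 := by
    intro e he
    rcases Finset.mem_union.1 he with h | h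
    · obtain ⟨e', he', rfl⟩ := Finset.mem_image.1 h
      obtain ⟨h1, h2⟩ := hE e' he'
      simpa [ρ, J, hjU _ h1, hjU _ h2, hg _ h1, hg _ h2] using hf e' he'
    · obtain ⟨h1, h2⟩ := hE₂mem e h
      have h3 : U.card ≤ e.2 := h1.trans (Fin.lt_def.1 h2).le
      simpa [ρ, not_lt.2 h1, not_lt.2 h3] using h2
  have hJinj : Set.InjOn J Q := fun q hq q' hq' h => by
    rw [← hKJ q (hQU q hq).1 (hQU q hq).2, h, hKJ q' (hQU q' hq').1 (hQU q' hq').2]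
  have hQcard : (Q.image J).card = Q.card := Finset.card_image_of_injOn hJinj
  obtain ⟨R, hR, hRcard⟩ := Finset.exists_subset_card_eq (s := E₂) (n := p - Q.card) (by omega)
  have hdisj : Disjoint (Q.image J) R := by
    refine Finset.disjoint_left.2 fun e he he' => ?_
    obtain ⟨q, hq, rfl⟩ := Finset.mem_image.1 he
    have h1 := (hE₂mem _ (hR he')).1
    have h2 := hjU _ (hQU q hq).1
    exact absurd h1 (not_le.2 h2)
  have push : ∀ (a b : V) (es : List (V × V)), IsPath E a es b →
      IsPath G.Edge (j a) (es.map J) (j b) ∧ weight G.w (es.map J) = weight w es := by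
    intro a b es
    induction es generalizing a with
    | nil =>
      intro h
      obtain rfl : a = b := h
      exact ⟨rfl, rfl⟩
    | cons e es ih =>
      rintro ⟨rfl, he, h⟩
      obtain ⟨h1, h2⟩ := ih _ h
      refine ⟨⟨rfl, Finset.mem_union_left _ (Finset.mem_image_of_mem J he), h1⟩, ?_⟩
      simp only [List.map_cons, weight_cons, h2, hGw e (hE e he).1 (hE e he).2]
  have hP : ∀ q ∈ Q.image J ∪ R, G.Reachable q.1 q.2 := by
    intro q hq
    rcases Finset.mem_union.1 hq with h | h
    · obtain ⟨q', hq', rfl⟩ := Finset.mem_image.1 h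
      obtain ⟨es, hes⟩ := hQ q' hq'
      exact WDigraph.reachableOn_iff.2 ⟨_, (push _ _ es hes).1⟩
    · exact WDigraph.reachableOn_iff.2 ⟨[q], rfl, Finset.mem_union_right _ (hR h), rfl⟩
  have hle : minPresD m G (Q.image J ∪ R) ≤ DADP m p :=
    minPresD_le_DADP hG ρ hrank (by rw [Finset.card_union_of_disjoint hdisj]; omega) hP
  obtain ⟨F, hF, hFcard⟩ := exists_preserver_card_eq_minPresD hP
  rw [WDigraph.isExactPreserver_iff hG] at hF
  have pull : ∀ (a : V) (t : Fin m) (es : List (Fin m × Fin m)), a ∈ U → IsPath F (j a) es t →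
      IsPath (E.filter fun e => J e ∈ F) a (es.map K) (g t) ∧
        weight w (es.map K) = weight G.w es := by
    intro a t es
    induction es generalizing a with
    | nil =>
      intro ha h
      obtain rfl : j a = t := h
      exact ⟨(hg a ha).symm, rfl⟩
    | cons e es ih =>
      rintro ha ⟨h1, he, h⟩
      rcases Finset.mem_union.1 (hF.1 he) with h' | h'
      · obtain ⟨e', he', rfl⟩ := Finset.mem_image.1 h'
        obtain ⟨hu1, hu2⟩ := hE e' he'
        obtain ⟨h2, h3⟩ := ih e'.2 hu2 h
        obtain rfl : e'.1 = a := hj hu1 ha h1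
        rw [List.map_cons, hKJ e' hu1 hu2, weight_cons, weight_cons, h3, hGw e' hu1 hu2]
        exact ⟨⟨rfl, Finset.mem_filter.2 ⟨he', he⟩, h2⟩, rfl⟩
      · have h4 := (hE₂mem e h').1
        rw [h1] at h4
        exact absurd h4 (not_le.2 (hjU a ha))
  refine ⟨E.filter fun e => J e ∈ F, Finset.filter_subset _ _, ?_, fun q hq => ?_⟩
  · refine le_trans ?_ (hFcard.trans_le hle)
    refine Finset.card_le_card_of_injOn J (fun e he => (Finset.mem_filter.1 he).2) ?_
    intro e he e' he' h
    obtain ⟨h1, h2⟩ := hE e (Finset.mem_filter.1 he).1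
    obtain ⟨h1', h2'⟩ := hE e' (Finset.mem_filter.1 he').1
    rw [← hKJ e h1 h2, h, hKJ e' h1' h2']
  · obtain ⟨h1, h2⟩ := hQU q hq
    obtain ⟨es, hes, hs⟩ := hF.2 (J q) (Finset.mem_union_left _ (Finset.mem_image_of_mem J hq))
    obtain ⟨h3, h4⟩ := pull q.1 (j q.2) es h1 hes
    rw [hg _ h2] at h3
    refine ⟨es.map K, h3, h3.mono (Finset.filter_subset _ _), fun es' hes' => ?_⟩
    obtain ⟨h5, h6⟩ := push _ _ es' hes'
    rw [h4, ← h6]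
    exact hs.2 _ h5

end Embedding

namespace EdgePath

variable {V : Type} {F : Finset (V × V)} {w : V × V → ℝ} {s t a b : V} {es A B C : List (V × V)}

lemma IsPath.weight_pos (hw : ∀ e ∈ F, 0 < w e) (h : IsPath F s es t) (hne : s ≠ t) :
    0 < weight w es := by
  cases es with
  | nil => exact absurd h hne
  | cons e es =>
    have h1 := hw e h.2.1
    have h2 := h.2.2.weight_nonneg hw
    rw [weight_cons]
    linarith

open Classical in
/-- A shortest walk with the fewest edges outside the list `π`. -/
def IsTight (F : Finset (V × V)) (w : V × V → ℝ) (π : List (V × V)) (s t : V)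
    (es : List (V × V)) : Prop :=
  IsShortest F w s t es ∧
    ∀ es', IsShortest F w s t es' → es.countP (· ∉ π) ≤ es'.countP (· ∉ π)

variable {π : List (V × V)}

lemma IsShortest.exists_isTight (h : IsShortest F w s t es) : ∃ es', IsTight F w π s t es' := by
  classical
  obtain ⟨m, hm, hmin⟩ := exists_minimalFor_of_wellFoundedLT (IsShortest F w s t)
    (fun es => es.countP (· ∉ π)) ⟨es, h⟩
  refine ⟨m, hm, fun es' hes' => ?_⟩
  rcases le_total (m.countP (· ∉ π)) (es'.countP (· ∉ π)) with hle | hle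
  · exact hle
  · exact hmin hes' hle

lemma IsTight.left (h : IsTight F w π s t (A ++ B)) (hA : IsPath F s A a) (hB : IsPath F a B t) :
    IsTight F w π s a A := by
  refine ⟨h.1.left hA hB, fun A' hA' => ?_⟩
  have h1 := h.2 (A' ++ B) (IsShortest.replace (A := []) h.1 rfl hA'.1 hB (hA'.2 _ hA))
  simpa only [List.countP_append, add_le_add_iff_right] using h1

lemma IsTight.right (h : IsTight F w π s t (A ++ B)) (hA : IsPath F s A a) (hB : IsPath F a B t) :
    IsTight F w π a t B := by
  refine ⟨h.1.right hA hB, fun B' hB' => ?_⟩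
  have h1 : IsShortest F w s t (A ++ B' ++ []) :=
    IsShortest.replace (B := B) (C := []) (by simpa using h.1) hA hB'.1 rfl (hB'.2 _ hB)
  have h2 := h.2 (A ++ B') (by simpa using h1)
  simpa only [List.countP_append, add_le_add_iff_left] using h2

open Classical in
/-- The position of a vertex among the heads of the edges of `π`. -/
noncomputable def position (π : List (V × V)) (v : V) : ℕ := (π.map Prod.snd).idxOf v

lemma exists_subpath_of_position_lt (hw : ∀ e ∈ F, 0 < w e) (hπ : IsShortest F w s t π)
    (ha : a ∈ π.map Prod.snd) (hb : b ∈ π.map Prod.snd) (hlt : position π a < position π b) :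
    ∃ B, IsShortest F w a b B ∧ ∀ e ∈ B, e ∈ π := by
  classical
  obtain ⟨f, hf, rfl⟩ := List.mem_map.1 ha
  obtain ⟨X, Y, rfl⟩ := List.append_of_mem hf
  have hbY : b ∈ Y.map Prod.snd := by
    by_contra hbY
    have hbX : b ∈ (X ++ [f]).map Prod.snd := by
      simp only [List.map_append, List.map_cons, List.mem_append, List.mem_cons] at hb
      simp only [List.map_append, List.map_cons, List.map_nil, List.mem_append, List.mem_singleton]
      tauto
    have h1 : position (X ++ f :: Y) b < X.length + 1 := by
      have : X ++ f :: Y = (X ++ [f]) ++ Y := by simp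
      rw [position, this, List.map_append, List.idxOf_append_of_mem hbX]
      simpa using List.idxOf_lt_length_of_mem hbX
    have hfX : f.2 ∉ X.map Prod.snd := fun hmem => by
      have hnd := hπ.nodup_snd hw
      rw [List.map_append, List.nodup_append] at hnd
      exact hnd.2.2 _ hmem f.2 (by simp) rfl
    have h2 : position (X ++ f :: Y) f.2 = X.length := by
      rw [position, List.map_append, List.idxOf_append_of_notMem hfX]
      simp
    omega
  obtain ⟨f', hf', rfl⟩ := List.mem_map.1 hbY
  obtain ⟨X', Y', rfl⟩ := List.append_of_mem hf'
  have h1 := isPath_append_cons.1 hπ.1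
  have h2 := isPath_append_cons.1 h1.2.2
  have h3 : IsPath F f.2 (X' ++ [f']) f'.2 := isPath_concat.2 ⟨h2.1, h2.2.1, rfl⟩
  refine ⟨X' ++ [f'], IsShortest.middle (A := X ++ [f]) (C := Y') (by simpa using hπ)
    (isPath_concat.2 ⟨h1.1, h1.2.1, rfl⟩) h3 h2.2.2, fun e he => ?_⟩
  simp only [List.mem_append, List.mem_cons, List.not_mem_nil, or_false] at he ⊢
  tauto

end EdgePath

section Shortcut

variable {V : Type} {H P : Finset (V × V)} {w : V × V → ℝ} {o : V × V → V × V} {s t : V}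
  {π : List (V × V)} {U : Finset V}

open Classical in
/-- The edges of `H` that enter a vertex of `U` and do not belong to `π`. -/
noncomputable def entryEdges (H : Finset (V × V)) (π : List (V × V)) (U : Finset V) :
    Finset (V × V) :=
  H.filter fun e => e.2 ∈ U ∧ e ∉ π

open Classical in
/-- Pairs of vertices of `U`, in reverse order along `π`, joined by a shortest walk with at most
one entry edge. -/
noncomputable def shortcutEdges (H : Finset (V × V)) (w : V × V → ℝ) (π : List (V × V))
    (U : Finset V) : Finset (V × V) :=
  (U ×ˢ U).filter fun d => position π d.2 < position π d.1 ∧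
    ∃ B e, IsShortest H w d.1 d.2 B ∧ ∀ e' ∈ B, e' ∈ entryEdges H π U → e' = e

lemma exists_first_entry {X : List (V × V)} (hX : ∃ e ∈ X, e ∈ entryEdges H π U) :
    ∃ A e B, X = A ++ e :: B ∧ e ∈ entryEdges H π U ∧ ∀ e' ∈ A, e' ∉ entryEdges H π U := by
  classical
  obtain ⟨e, he, heE⟩ := hX
  obtain ⟨e', A, B, hA, he', rfl, -⟩ :=
    List.exists_of_eraseP (p := fun e => decide (e ∈ entryEdges H π U)) he (by simpa using heE)
  exact ⟨A, e', B, rfl, by simpa using he', fun f hf => by simpa using hA f hf⟩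

/-- A tight walk from a vertex of `U` follows a walk of shortcut edges up to its last entry. -/
lemma EdgePath.IsTight.exists_shortcut_path (hw : ∀ e ∈ H, 0 < w e) (hπ : IsShortest H w s t π)
    (hU : ∀ v ∈ U, v ∈ π.map Prod.snd) {wD : V × V → ℝ}
    (hwD : ∀ d ∈ shortcutEdges H w π U, ∀ B, IsShortest H w d.1 d.2 B → wD d = weight w B)
    {a z : V} {X : List (V × V)} (hX : IsTight H w π a z X) (ha : a ∈ U) :
    ∃ M C b, X = M ++ C ∧ b ∈ U ∧ IsPath H a M b ∧ IsPath H b C z ∧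
      (∀ e ∈ C, e ∉ entryEdges H π U) ∧
      ∃ ds, IsPath (shortcutEdges H w π U) a ds b ∧ weight wD ds = weight w M := by
  classical
  induction hlen : X.length using Nat.strong_induction_on generalizing a X with
  | _ N ih =>
  by_cases hent : ∃ e ∈ X, e ∈ entryEdges H π U
  · obtain ⟨X₀, e, X₁, rfl, he, hX₀⟩ := exists_first_entry hent
    obtain ⟨heH, heU, heπ⟩ := Finset.mem_filter.1 he
    have hp := isPath_append_cons.1 hX.1.1
    have hpre : IsPath H a (X₀ ++ [e]) e.2 := isPath_concat.2 ⟨hp.1, hp.2.1, rfl⟩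
    have hX' : IsTight H w π a z ((X₀ ++ [e]) ++ X₁) := by simpa using hX
    have hL := hX'.left hpre hp.2.2
    have hR := hX'.right hpre hp.2.2
    obtain ⟨M, C, b, rfl, hb, hM, hC, hCe, ds, hds, hdw⟩ :=
      ih X₁.length (by simp [← hlen]; omega) hR heU rfl
    have hne : a ≠ e.2 := fun h => by
      have h' := hL.1
      rw [← h] at h'
      simpa using h'.eq_nil hw
    have hpos : position π e.2 < position π a := by
      by_contra hcon
      rcases (not_lt.1 hcon).lt_or_eq with hlt | heq
      · obtain ⟨B, hB, hBπ⟩ := exists_subpath_of_position_lt hw hπ (hU _ ha) (hU _ heU) hlt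
        have h1 := hL.2 B hB
        have h2 : B.countP (· ∉ π) = 0 := List.countP_eq_zero.2 fun e he => by simpa using hBπ e he
        rw [h2] at h1
        have h3 := List.countP_eq_zero.1 (Nat.le_zero.1 h1) e (by simp)
        simp [heπ] at h3
      · exact hne ((List.idxOf_inj (hU _ ha)).1 heq)
    have hd : (a, e.2) ∈ shortcutEdges H w π U := by
      refine Finset.mem_filter.2 ⟨Finset.mem_product.2 ⟨ha, heU⟩, hpos, X₀ ++ [e], e, hL.1, ?_⟩
      intro e' he' hE'
      rcases List.mem_append.1 he' with h | h
      · exact absurd hE' (hX₀ e' h)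
      · simpa using h
    refine ⟨(X₀ ++ [e]) ++ M, C, b, by simp, hb, hpre.append hM, hC, hCe,
      (a, e.2) :: ds, ⟨rfl, hd, hds⟩, ?_⟩
    rw [weight_cons, weight_append (A := X₀ ++ [e]), hdw, hwD _ hd _ hL.1]
  · push Not at hent
    exact ⟨[], X, a, rfl, ha, rfl, hX.1.1, hent, [], rfl, rfl⟩

/-- The number of entry edges of a minimal preserver is at most the number of demand pairs plus
the size of a preserver of the DAG of shortcut edges. -/
lemma IsOwnership.card_entryEdges_le [Finite V] (ho : IsOwnership H w P o)
    (hw : ∀ e ∈ H, 0 < w e) (hP : ∀ q ∈ P, ∃ es, IsPath H q.1 es q.2)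
    (hπ : IsShortest H w s t π) (hU : ∀ v ∈ U, v ∈ π.map Prod.snd) {m r : ℕ}
    (hm : U.card + 2 * r ≤ m) (hr : P.card ≤ r * r) :
    (entryEdges H π U).card ≤ P.card + DADP m P.card := by
  classical
  rcases (entryEdges H π U).eq_empty_or_nonempty with hempty | ⟨e₀, he₀⟩
  · simp [hempty]
  have : Nonempty (V × V) := ⟨e₀⟩
  have hE : ∀ d ∈ shortcutEdges H w π U, ∃ B e, IsShortest H w d.1 d.2 B ∧
      ∀ e' ∈ B, e' ∈ entryEdges H π U → e' = e := fun d hd => (Finset.mem_filter.1 hd).2.2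
  choose! B ε hB hε using hE
  have hEU : ∀ d ∈ shortcutEdges H w π U, d.1 ∈ U ∧ d.2 ∈ U := fun d hd =>
    Finset.mem_product.1 (Finset.mem_filter.1 hd).1
  have hEpos : ∀ d ∈ shortcutEdges H w π U, position π d.2 < position π d.1 := fun d hd =>
    (Finset.mem_filter.1 hd).2.1
  let wD : V × V → ℝ := fun d => weight w (B d)
  have hwD : ∀ d ∈ shortcutEdges H w π U, ∀ B, IsShortest H w d.1 d.2 B → wD d = weight w B :=
    fun d hd B' hB' => (hB d hd).weight_eq hB'
  have hwDpos : ∀ d ∈ shortcutEdges H w π U, 0 < wD d := fun d hd =>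
    (hB d hd).1.weight_pos hw fun h => by simpa [h] using hEpos d hd
  have expand : ∀ (a b : V) (ds : List (V × V)), IsPath (shortcutEdges H w π U) a ds b →
      ∃ M, IsPath H a M b ∧ weight w M = weight wD ds ∧
        ∀ e ∈ M, e ∈ entryEdges H π U → ∃ d ∈ ds, e = ε d := by
    intro a b ds
    induction ds generalizing a with
    | nil =>
      intro h
      exact ⟨[], h, rfl, by simp⟩
    | cons d ds ih =>
      rintro ⟨rfl, hd, h⟩
      obtain ⟨M, hM, hMw, hMe⟩ := ih _ h
      refine ⟨B d ++ M, (hB d hd).1.append hM, by simp [hMw, wD], fun e he hee => ?_⟩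
      rcases List.mem_append.1 he with h' | h'
      · exact ⟨d, by simp, hε d hd e h' hee⟩
      · obtain ⟨d', hd', heq⟩ := hMe e h' hee
        exact ⟨d', by simp [hd'], heq⟩
  have htight : ∀ q ∈ P, ∃ es, IsTight H w π q.1 q.2 es := fun q hq => by
    obtain ⟨es, hes⟩ := hP q hq
    obtain ⟨es', hes'⟩ := hes.exists_isShortest hw
    exact hes'.exists_isTight
  choose! τ hτ using htight
  let P' := P.filter fun q => ∃ e ∈ τ q, e ∈ entryEdges H π U
  have key : ∀ q ∈ P', ∃ d e₁ : V × V, (d.1 ∈ U ∧ d.2 ∈ U) ∧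
      (∃ ds, IsPath (shortcutEdges H w π U) d.1 ds d.2) ∧
      ∀ ds, IsShortest (shortcutEdges H w π U) wD d.1 d.2 ds →
        ∃ es, IsShortest H w q.1 q.2 es ∧
          ∀ e ∈ es, e ∈ entryEdges H π U → e = e₁ ∨ ∃ f ∈ ds, e = ε f := by
    intro q hq
    obtain ⟨hqP, hent⟩ := Finset.mem_filter.1 hq
    obtain ⟨A, e₁, X, hX, he₁, hA⟩ := exists_first_entry hent
    have ht := hτ q hqP
    rw [hX] at ht
    have hp := isPath_append_cons.1 ht.1.1
    have hpre : IsPath H q.1 (A ++ [e₁]) e₁.2 := isPath_concat.2 ⟨hp.1, hp.2.1, rfl⟩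
    have ht' : IsTight H w π q.1 q.2 ((A ++ [e₁]) ++ X) := by simpa using ht
    have he₁U : e₁.2 ∈ U := (Finset.mem_filter.1 he₁).2.1
    obtain ⟨M, C, b, rfl, hb, hM, hC, hCe, ds₀, hds₀, hdw₀⟩ :=
      (ht'.right hpre hp.2.2).exists_shortcut_path hw hπ hU hwD he₁U
    refine ⟨(e₁.2, b), e₁, ⟨he₁U, hb⟩, ⟨ds₀, hds₀⟩, fun ds hds => ?_⟩
    obtain ⟨M', hM', hMw', hMe'⟩ := expand _ _ ds hds.1
    refine ⟨(A ++ [e₁]) ++ M' ++ C, IsShortest.replace (B := M) (by simpa using ht.1) hpre hM' hC ?_,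
      fun e he hee => ?_⟩
    · rw [hMw', ← hdw₀]
      exact hds.2 _ hds₀
    · rcases List.mem_append.1 he with he | he
      · rcases List.mem_append.1 he with he | he
        · rcases List.mem_append.1 he with he | he
          · exact absurd hee (hA e he)
          · exact Or.inl (by simpa using he)
        · exact Or.inr (hMe' e he hee)
      · exact absurd hee (hCe e he)
  choose! δ φ hδU hδr hδ using key
  obtain ⟨F, hFE, hFcard, hF⟩ := exists_preserver_le_DADP (Q := P'.image δ) (w := wD) (m := m)
    (p := P.card) (r := r) (f := fun v => (π.map Prod.snd).length - position π v) hEU hwDpos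
    (fun d hd => by
      have h1 := hEpos d hd
      have h2 : position π d.1 ≤ (π.map Prod.snd).length := List.idxOf_le_length
      omega)
    (by simpa only [Finset.forall_mem_image] using hδU)
    (by simpa only [Finset.forall_mem_image] using hδr)
    (Finset.card_image_le.trans (Finset.card_filter_le _ _)) hm hr
  have hsub : entryEdges H π U ⊆ P'.image φ ∪ F.image ε := by
    intro e he
    have heH := (Finset.mem_filter.1 he).1
    obtain ⟨hoP, hoe⟩ := ho e heH
    have hq : o e ∈ P' := Finset.mem_filter.2 ⟨hoP, e, hoe _ (hτ _ hoP).1, he⟩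
    obtain ⟨ds, hds, hs⟩ := hF _ (Finset.mem_image_of_mem δ hq)
    obtain ⟨es, hes, hese⟩ := hδ _ hq ds hs
    rcases hese e (hoe es hes) he with h | ⟨f, hf, h⟩
    · exact Finset.mem_union_left _ (h ▸ Finset.mem_image_of_mem φ hq)
    · exact Finset.mem_union_right _ (h ▸ Finset.mem_image_of_mem ε (hds.mem f hf))
  calc (entryEdges H π U).card ≤ (P'.image φ ∪ F.image ε).card := Finset.card_le_card hsub
    _ ≤ (P'.image φ).card + (F.image ε).card := Finset.card_union_le _ _
    _ ≤ P.card + DADP m P.card := add_le_add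
        (Finset.card_image_le.trans (Finset.card_filter_le _ _)) (Finset.card_image_le.trans hFcard)

lemma IsOwnership.card_sq_le_DADP [Fintype V] (ho : IsOwnership H w P o)
    (hw : ∀ e ∈ H, 0 < w e) (hP : ∀ q ∈ P, ∃ es, IsPath H q.1 es q.2) (hH : H.Nonempty)
    {k m r : ℕ} (hk : H.card ≤ k * P.card) (hm : k + 2 * r ≤ m) (hr : P.card ≤ r * r) :
    (H.card : ℝ) ^ 2 ≤ 3 * Fintype.card V * P.card * (P.card + k + DADP m P.card) := by
  classical
  obtain ⟨q, hq, S, hS, hSk, hle⟩ := ho.exists_large_indegree hH hk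
  obtain ⟨es, hes⟩ := hP q hq
  obtain ⟨π, hπ⟩ := hes.exists_isShortest hw
  have hSπ : ∀ e ∈ S, e ∈ π := fun e he => by
    obtain ⟨heH, rfl⟩ := Finset.mem_filter.1 (hS he)
    exact (ho e heH).2 π hπ
  have hinj : Set.InjOn Prod.snd {e | e ∈ π} := fun e he e' he' h => hπ.eq_of_snd_eq hw he he' h
  let U := S.image Prod.snd
  have hUcard : U.card ≤ k := Finset.card_image_le.trans hSk
  have hentry := ho.card_entryEdges_le hw hP hπ (U := U) (m := m)
    (fun v hv => by
      obtain ⟨e, he, rfl⟩ := Finset.mem_image.1 hv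
      exact List.mem_map_of_mem (hSπ e he)) (by omega) hr
  have hsum : ∑ e ∈ S, (H.filter fun e' => e'.2 = e.2).card = (H.filter fun e => e.2 ∈ U).card := by
    rw [Finset.card_eq_sum_card_fiberwise (s := H.filter fun e => e.2 ∈ U) (f := Prod.snd) (t := U)
      (fun e he => (Finset.mem_filter.1 he).2), Finset.sum_image (hinj.mono hSπ)]
    refine Finset.sum_congr rfl fun e he => ?_
    rw [Finset.filter_filter]
    congr 1
    refine Finset.filter_congr fun e' _ => ⟨fun h => ⟨?_, h⟩, fun h => h.2⟩
    exact h ▸ Finset.mem_image_of_mem _ he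
  have hcount : (H.filter fun e => e.2 ∈ U).card ≤ (entryEdges H π U).card + U.card := by
    have h1 : (H.filter fun e => e.2 ∈ U) ⊆
        entryEdges H π U ∪ H.filter fun e => e.2 ∈ U ∧ e ∈ π := by
      intro e he
      simp only [entryEdges, Finset.mem_union, Finset.mem_filter] at he ⊢
      tauto
    refine (Finset.card_le_card h1).trans ((Finset.card_union_le _ _).trans ?_)
    refine Nat.add_le_add_left (Finset.card_le_card_of_injOn Prod.snd
      (fun e he => (Finset.mem_filter.1 he).2.1) ?_) _
    exact hinj.mono fun e he => (Finset.mem_filter.1 he).2.2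
  have htotal : ∑ e ∈ S, (H.filter fun e' => e'.2 = e.2).card ≤
      P.card + k + DADP m P.card := by omega
  refine hle.trans (mul_le_mul_of_nonneg_left ?_ (by positivity))
  exact_mod_cast htotal

end Shortcut

/-- the directed-to-DAG reduction for exact distance preservers. -/
theorem directed_to_dag_reduction :
    ∃ C C' : ℝ, 1 ≤ C ∧ 1 ≤ C' ∧ ∀ n p : ℕ, 1 ≤ n → 1 ≤ p →
      (DDP n p : ℝ) ≤
        C * ((DADP (⌈C' * (DDP n p : ℝ) / (p : ℝ)⌉₊) p : ℝ) ^ ((1 : ℝ) / 2) *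
              (n : ℝ) ^ ((1 : ℝ) / 2) * (p : ℝ) ^ ((1 : ℝ) / 2) +
            (n : ℝ) ^ ((1 : ℝ) / 2) * (p : ℝ) + (n : ℝ)) := by
  refine ⟨24, 6, by norm_num, by norm_num, fun n p hn hp => ?_⟩
  set m := ⌈6 * (DDP n p : ℝ) / (p : ℝ)⌉₊ with hm
  have hn' : (1 : ℝ) ≤ n := by exact_mod_cast hn
  have hp' : (1 : ℝ) ≤ p := by exact_mod_cast hp
  simp only [← Real.sqrt_eq_rpow]
  have hb : (√n * p : ℝ) ^ 2 = n * p ^ 2 := by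
    rw [mul_pow, Real.sq_sqrt (by positivity)]
  have ha : (√(DADP m p) * √n * √p : ℝ) ^ 2 = DADP m p * n * p := by
    rw [mul_pow, mul_pow, Real.sq_sqrt (by positivity), Real.sq_sqrt (by positivity),
      Real.sq_sqrt (by positivity)]
  have ha0 : 0 ≤ (√(DADP m p) * √n * √p : ℝ) := by positivity
  have hb0 : 0 ≤ (√n * p : ℝ) := by positivity
  generalize (√(DADP m p) * √n * √p : ℝ) = a at ha ha0 ⊢
  generalize (√n * p : ℝ) = b at hb hb0 ⊢
  by_contra! hcon
  have hD0 : DDP n p ≠ 0 := fun h => by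
    rw [h, Nat.cast_zero] at hcon
    linarith
  obtain ⟨H, w, P, o, hH, hP, hw, hreach, ho⟩ := exists_isOwnership_of_DDP_ne_zero hD0
  have hHne : H.Nonempty := Finset.card_pos.1 (by omega)
  set D : ℝ := (DDP n p : ℝ) with hD
  have hDa : (24 * a) ^ 2 ≤ D ^ 2 := pow_le_pow_left₀ (by positivity) (by linarith) 2
  have hDb : (24 * b) ^ 2 ≤ D ^ 2 := pow_le_pow_left₀ (by positivity) (by linarith) 2
  have hDn : 24 * n ≤ D := by linarith
  have hDpos : 0 < D := by linarith
  have hDsq : 0 < D ^ 2 := by positivity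
  rcases le_or_gt n p with hnp | hpn
  · have h1 := ho.card_sq_le hw hreach
    rw [hH, hP, Fintype.card_fin] at h1
    have h2 : D ^ 2 ≤ 2 * (n : ℝ) ^ 2 * p := by
      rw [hD]
      exact_mod_cast h1
    have h3 : (n : ℝ) ≤ p := by exact_mod_cast hnp
    have h4 : (n : ℝ) ^ 2 * p ≤ n * p ^ 2 := by
      have : (0 : ℝ) ≤ n * p := by positivity
      nlinarith
    nlinarith
  · have hpn' : (p : ℝ) ≤ n := by exact_mod_cast hpn.le
    have hp0 : (0 : ℝ) < p := by linarith
    set k := ⌈D / p⌉₊ with hk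
    have hkD : D / p ≤ k := Nat.le_ceil _
    have hk1 : (k : ℝ) ≤ 2 * D / p := by
      have h1 : (k : ℝ) < D / p + 1 := Nat.ceil_lt_add_one (by positivity)
      have h2 : 1 ≤ D / p := by
        rw [le_div_iff₀ hp0]
        linarith
      rw [mul_div_assoc]
      linarith
    have hkp : H.card ≤ k * P.card := by
      rw [hH, hP]
      rw [div_le_iff₀ hp0, hD] at hkD
      exact_mod_cast hkD
    have hkm : k + 2 * k ≤ m := by
      have h1 : 6 * D / p ≤ m := Nat.le_ceil _
      have h2 : 6 * D / p = 3 * (2 * D / p) := by ring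
      have h3 : (k : ℝ) + 2 * k ≤ m := by linarith
      exact_mod_cast h3
    have hpk : P.card ≤ k * k := by
      rw [hP]
      have h1 : (D / p) ^ 2 ≤ (k : ℝ) ^ 2 := pow_le_pow_left₀ (by positivity) hkD 2
      have h2 : (p : ℝ) ≤ (D / p) ^ 2 := by
        rw [div_pow, le_div_iff₀ (by positivity)]
        have : (p : ℝ) * p ^ 2 ≤ n * p ^ 2 := mul_le_mul_of_nonneg_right hpn' (by positivity)
        nlinarith
      have h3 : (p : ℝ) ≤ k * k := by
        rw [← sq]
        exact h2.trans h1
      exact_mod_cast h3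
    have h1 := ho.card_sq_le_DADP hw hreach hHne hkp hkm hpk
    rw [hH, hP, Fintype.card_fin] at h1
    have h2 : 3 * (n : ℝ) * p * (p + k + DADP m p) ≤
        3 * (n : ℝ) * p * (p + 2 * D / p + DADP m p) := by gcongr
    have h3 : 3 * (n : ℝ) * p * (p + 2 * D / p + DADP m p) =
        3 * (n * p ^ 2) + 6 * n * D + 3 * (DADP m p * n * p) := by
      field_simp
      ring
    rw [h3, ← ha, ← hb] at h2
    have h4 : 6 * n * D ≤ D ^ 2 / 4 := by nlinarith
    have h5 := h1.trans h2
    nlinarith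
end

section
/- Let G be a positively weighted directed acyclic graph with topological order v₁,…,vₙ (every edge goes from v_i to v_j with i < j), and let W be a real number greater than the sum of all edge weights of G. Let G' be the undirected weighted graph on {v₁,…,vₙ} that has, for each directed edge (v_i,v_j) of G with i < j, an undirected edge {v_i,v_j} of weight w(v_i,v_j) + W·(j−i). Then for all i < j such that v_j is reachable from v_i in G: (a) dist_{G'}(v_i,v_j) = dist_G(v_i,v_j) + W·(j−i); and (b) if the shortest path from v_i to v_j in G is unique, then the shortest path between v_i and v_j in G' is unique and traverses exactly the same sequence of vertices. -/
open Finset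

theorem isWalkOn_iff_isChain {V : Type} {F : Finset (V × V)} {s t : V} {l : List V} :
    IsWalkOn F s t l ↔
      l.IsChain (fun a b => (a, b) ∈ F) ∧ l.head? = some s ∧ l.getLast? = some t :=
  Iff.rfl

theorem isWalkOn_singleton_iff {V : Type} {F : Finset (V × V)} {s t a : V} :
    IsWalkOn F s t [a] ↔ a = s ∧ a = t := by
  simp [isWalkOn_iff_isChain]

theorem isWalkOn_cons_cons_iff {V : Type} {F : Finset (V × V)} {s t a b : V} {l : List V} :
    IsWalkOn F s t (a :: b :: l) ↔ a = s ∧ (a, b) ∈ F ∧ IsWalkOn F b t (b :: l) := by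
  simp [isWalkOn_iff_isChain, and_assoc, and_comm, and_left_comm]

theorem not_isWalkOn_nil {V : Type} {F : Finset (V × V)} {s t : V} : ¬ IsWalkOn F s t [] := by
  simp [isWalkOn_iff_isChain]

namespace WGraph

theorem isWalkOn_iff_isChain {V : Type} {F : Finset (Sym2 V)} {s t : V} {l : List V} :
    IsWalkOn F s t l ↔
      l.IsChain (fun a b => s(a, b) ∈ F) ∧ l.head? = some s ∧ l.getLast? = some t :=
  Iff.rfl

theorem isWalkOn_singleton_iff {V : Type} {F : Finset (Sym2 V)} {s t a : V} :
    IsWalkOn F s t [a] ↔ a = s ∧ a = t := by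
  simp [isWalkOn_iff_isChain]

theorem isWalkOn_cons_cons_iff {V : Type} {F : Finset (Sym2 V)} {s t a b : V} {l : List V} :
    IsWalkOn F s t (a :: b :: l) ↔ a = s ∧ s(a, b) ∈ F ∧ IsWalkOn F b t (b :: l) := by
  simp [isWalkOn_iff_isChain, and_assoc, and_comm, and_left_comm]

theorem not_isWalkOn_nil {V : Type} {F : Finset (Sym2 V)} {s t : V} :
    ¬ IsWalkOn F s t [] := by
  simp [isWalkOn_iff_isChain]

theorem walkWeight_singleton {V : Type} (G : WGraph V) (a : V) : G.walkWeight [a] = 0 := by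
  simp [walkWeight]

theorem walkWeight_cons_cons {V : Type} (G : WGraph V) (a b : V) (l : List V) :
    G.walkWeight (a :: b :: l) = G.w s(a, b) + G.walkWeight (b :: l) := by
  simp [walkWeight]

end WGraph

namespace WDigraph

theorem walkWeight_singleton {V : Type} (G : WDigraph V) (a : V) : G.walkWeight [a] = 0 := by
  simp [walkWeight]

theorem walkWeight_cons_cons {V : Type} (G : WDigraph V) (a b : V) (l : List V) :
    G.walkWeight (a :: b :: l) = G.w (a, b) + G.walkWeight (b :: l) := by
  simp [walkWeight]

theorem IsWalk.mem_edge_of_mem_zip {V : Type} {G : WDigraph V} {s t : V} {l : List V}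
    (h : G.IsWalk s t l) {e : V × V} (he : e ∈ l.zip l.tail) : e ∈ G.Edge := by
  induction l generalizing s with
  | nil => simp at he
  | cons a l ih =>
    cases l with
    | nil => simp at he
    | cons b l =>
      obtain ⟨-, hab, hl⟩ := isWalkOn_cons_cons_iff.1 h
      rcases List.mem_cons.1 he with rfl | he
      · exact hab
      · exact ih hl he

theorem IsWalk.walkWeight_nonneg {V : Type} {G : WDigraph V} (hpos : G.PosWeights) {s t : V}
    {l : List V} (h : G.IsWalk s t l) : 0 ≤ G.walkWeight l := by
  refine List.sum_nonneg fun x hx => ?_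
  obtain ⟨e, he, rfl⟩ := List.mem_map.1 hx
  exact (hpos e (h.mem_edge_of_mem_zip he)).le

/-- In an acyclic graph no edge is traversed twice. -/
theorem IsWalk.walkWeight_le_sum {V : Type} [Preorder V] {G : WDigraph V}
    (hpos : G.PosWeights) (htopo : ∀ e ∈ G.Edge, e.1 < e.2) {s t : V} {l : List V}
    (h : G.IsWalk s t l) : G.walkWeight l ≤ ∑ e ∈ G.Edge, G.w e := by
  classical
  have hchain : l.IsChain (· < ·) := List.IsChain.imp (fun a b hab => htopo (a, b) hab) h.1
  have hnodup : l.Nodup := hchain.pairwise.imp fun hab => hab.ne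
  have hzip : (l.zip l.tail).Nodup := by
    refine List.Nodup.of_map Prod.snd ?_
    rw [List.map_snd_zip (by simp)]
    exact hnodup.sublist (List.tail_sublist _)
  rw [walkWeight, ← List.sum_toFinset _ hzip]
  refine Finset.sum_le_sum_of_subset_of_nonneg (fun e he => ?_) fun e he _ => (hpos e he).le
  exact h.mem_edge_of_mem_zip (List.mem_toFinset.1 he)

theorem dist_le_walkWeight {V : Type} {G : WDigraph V} (hpos : G.PosWeights) {s t : V}
    {l : List V} (h : G.IsWalk s t l) : G.dist s t ≤ G.walkWeight l := by
  refine csInf_le ⟨0, ?_⟩ ⟨l, h, rfl⟩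
  rintro _ ⟨l, hl, rfl⟩
  exact IsWalk.walkWeight_nonneg hpos hl

section Reweighting

variable {n : ℕ} {G : WDigraph (Fin n)} {G' : WGraph (Fin n)} {W : ℝ} {s t : Fin n}
  {l : List (Fin n)}

theorem IsWalk.undirected (hE' : G'.Edge = G.Edge.image fun e => s(e.1, e.2))
    (h : G.IsWalk s t l) : G'.IsWalk s t l := by
  refine ⟨List.IsChain.imp (fun a b hab => ?_) h.1, h.2⟩
  rw [hE']
  exact Finset.mem_image_of_mem (fun e : Fin n × Fin n => s(e.1, e.2)) hab

theorem IsWalk.walkWeight_reweight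
    (hw' : ∀ e ∈ G.Edge,
      G'.w s(e.1, e.2) = G.w e + W * (((e.2 : ℕ) : ℝ) - ((e.1 : ℕ) : ℝ)))
    (h : G.IsWalk s t l) :
    G'.walkWeight l = G.walkWeight l + W * (((t : ℕ) : ℝ) - ((s : ℕ) : ℝ)) := by
  induction l generalizing s with
  | nil => exact (not_isWalkOn_nil h).elim
  | cons a l ih =>
    cases l with
    | nil =>
      obtain ⟨rfl, rfl⟩ := isWalkOn_singleton_iff.1 h
      simp [walkWeight_singleton, WGraph.walkWeight_singleton]
    | cons b l =>
      obtain ⟨rfl, hab, hl⟩ := isWalkOn_cons_cons_iff.1 h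
      rw [walkWeight_cons_cons, WGraph.walkWeight_cons_cons, ih hl, hw' _ hab]
      ring

/-- A walk of the reweighted graph either follows edge directions throughout, or pays at least
`W` more than the displacement term. -/
theorem isWalk_or_le_walkWeight (hpos : G.PosWeights) (htopo : ∀ e ∈ G.Edge, e.1 < e.2)
    (hW : 0 ≤ W) (hE' : G'.Edge = G.Edge.image fun e => s(e.1, e.2))
    (hw' : ∀ e ∈ G.Edge,
      G'.w s(e.1, e.2) = G.w e + W * (((e.2 : ℕ) : ℝ) - ((e.1 : ℕ) : ℝ)))
    (h : G'.IsWalk s t l) :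
    G.IsWalk s t l ∨ W * (((t : ℕ) : ℝ) - ((s : ℕ) : ℝ)) + W ≤ G'.walkWeight l := by
  induction l generalizing s with
  | nil => exact (WGraph.not_isWalkOn_nil h).elim
  | cons a l ih =>
    cases l with
    | nil => exact Or.inl (isWalkOn_singleton_iff.2 (WGraph.isWalkOn_singleton_iff.1 h))
    | cons b l =>
      obtain ⟨rfl, hab, hl⟩ := WGraph.isWalkOn_cons_cons_iff.1 h
      rw [WGraph.walkWeight_cons_cons]
      have hdir : (a, b) ∈ G.Edge ∨ (b, a) ∈ G.Edge := by
        rw [hE', Finset.mem_image] at hab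
        obtain ⟨⟨c, d⟩, hcd, heq⟩ := hab
        rcases Sym2.eq_iff.1 heq with ⟨rfl, rfl⟩ | ⟨rfl, rfl⟩
        exacts [Or.inl hcd, Or.inr hcd]
      rcases hdir with hdir | hdir
      · rcases ih hl with hl' | hl'
        · exact Or.inl (isWalkOn_cons_cons_iff.2 ⟨rfl, hdir, hl'⟩)
        · right
          have h1 := hw' _ hdir
          have h2 := hpos _ hdir
          simp only at h1
          linarith
      · right
        have h1 := hw' _ hdir
        have h2 := hpos _ hdir
        have h3 : ((b : ℕ) : ℝ) + 1 ≤ ((a : ℕ) : ℝ) := by exact_mod_cast htopo _ hdir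
        have h4 : W * (((t : ℕ) : ℝ) - ((b : ℕ) : ℝ)) ≤ G'.walkWeight (b :: l) := by
          rcases ih hl with hl' | hl'
          · rw [hl'.walkWeight_reweight hw']
            linarith [hl'.walkWeight_nonneg hpos]
          · linarith
        rw [Sym2.eq_swap]
        simp only at h1
        nlinarith [mul_le_mul_of_nonneg_left h3 hW]

end Reweighting

end WDigraph

/-- the DAG-to-undirected reweighting preserves distances (shifted by
`W·(j−i)`) and unique shortest paths. Vertices are `Fin n` in topological order. -/
theorem dag_to_undirected_reweighting (n : ℕ) (G : WDigraph (Fin n))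
    (hpos : G.PosWeights)
    (htopo : ∀ e ∈ G.Edge, e.1 < e.2)
    (W : ℝ) (hW : (∑ e ∈ G.Edge, G.w e) < W)
    (G' : WGraph (Fin n))
    (hE' : G'.Edge = G.Edge.image fun e => s(e.1, e.2))
    (hw' : ∀ e ∈ G.Edge,
      G'.w s(e.1, e.2) = G.w e + W * (((e.2 : ℕ) : ℝ) - ((e.1 : ℕ) : ℝ))) :
    ∀ i j : Fin n, i < j → G.Reachable i j →
      -- (a) distances shift by `W·(j−i)`
      (G'.dist i j = G.dist i j + W * (((j : ℕ) : ℝ) - ((i : ℕ) : ℝ))) ∧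
      -- (b) unique shortest paths are preserved, with the same vertex sequence
      (∀ l : List (Fin n), G.IsWalk i j l → G.walkWeight l = G.dist i j →
        (∀ l₂, G.IsWalk i j l₂ → G.walkWeight l₂ = G.dist i j → l₂ = l) →
        G'.IsWalk i j l ∧ G'.walkWeight l = G'.dist i j ∧
          ∀ l', G'.IsWalk i j l' → G'.walkWeight l' = G'.dist i j → l' = l) := by
  intro i j _ hreach
  set c := W * (((j : ℕ) : ℝ) - ((i : ℕ) : ℝ)) with hc
  have hW0 : 0 ≤ W := (Finset.sum_nonneg fun e he => (hpos e he).le).trans hW.le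
  obtain ⟨l₀, hl₀⟩ := hreach
  have hdist : G.dist i j < W :=
    (WDigraph.dist_le_walkWeight hpos hl₀).trans_lt
      ((WDigraph.IsWalk.walkWeight_le_sum hpos htopo hl₀).trans_lt hW)
  have hshift : ∀ l, G.IsWalk i j l → G'.walkWeight l = G.walkWeight l + c :=
    fun l hl => hl.walkWeight_reweight hw'
  have hcases : ∀ l, G'.IsWalk i j l → G.IsWalk i j l ∨ c + W ≤ G'.walkWeight l :=
    fun l hl => WDigraph.isWalk_or_le_walkWeight hpos htopo hW0 hE' hw' hl
  have hlower : ∀ l, G'.IsWalk i j l → G.dist i j + c ≤ G'.walkWeight l := by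
    intro l hl
    rcases hcases l hl with hl' | hl'
    · rw [hshift l hl']
      linarith [WDigraph.dist_le_walkWeight hpos hl']
    · linarith
  have hmain : G'.dist i j = G.dist i j + c := by
    apply le_antisymm
    · rw [← sub_le_iff_le_add]
      refine le_csInf ⟨_, l₀, hl₀, rfl⟩ ?_
      rintro _ ⟨l, hl, rfl⟩
      rw [sub_le_iff_le_add, ← hshift l hl]
      refine csInf_le ⟨G.dist i j + c, ?_⟩ ⟨l, WDigraph.IsWalk.undirected hE' hl, rfl⟩
      rintro _ ⟨l, hl, rfl⟩
      exact hlower l hl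
    · refine le_csInf ⟨_, l₀, WDigraph.IsWalk.undirected hE' hl₀, rfl⟩ ?_
      rintro _ ⟨l, hl, rfl⟩
      exact hlower l hl
  refine ⟨hmain, fun l hl hlw huniq => ⟨hl.undirected hE', ?_, fun l' hl' hlw' => ?_⟩⟩
  · rw [hshift l hl, hlw, hmain]
  · rcases hcases l' hl' with h | h
    · refine huniq l' h ?_
      linarith [hshift l' h]
    · linarith
end
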